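/- A graded bounded poset whose flag f-vector satisfies the generalized Dehn–Sommerville equations has a cd-index; conversely, if a graded bounded poset has a cd-index, then its flag f-vector satisfies the generalized Dehn–Sommerville equations. -/

import Mathlib

open scoped Classical
open FreeAlgebra

noncomputable section

/-- The generator `a` of `ℤ⟨a,b⟩`. -/
def genA : FreeAlgebra ℤ Bool := FreeAlgebra.ι ℤ false

/-- The generator `b` of `ℤ⟨a,b⟩`. -/
def genB : FreeAlgebra ℤ Bool := FreeAlgebra.ι ℤ true

/-- The ab-word `u_K = u_1 ⋯ u_d`, with `u_i = b` if `i ∈ K` and `u_i = a` otherwise. -/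
def abWord (d : ℕ) (K : Finset ℕ) : FreeAlgebra ℤ Bool :=
  ((List.range d).map fun i => if i + 1 ∈ K then genB else genA).prod

/-- The map `ℤ⟨c,d⟩ → ℤ⟨a,b⟩` with `c ↦ a+b`, `d ↦ ab+ba`; the generator `false` plays
the role of `c` and `true` the role of `d` in the domain. -/
def cdMap : FreeAlgebra ℤ Bool →ₐ[ℤ] FreeAlgebra ℤ Bool :=
  FreeAlgebra.lift ℤ (fun x : Bool => if x then genA * genB + genB * genA else genA + genB)

variable {α : Type*} [Fintype α] [PartialOrder α] [BoundedOrder α]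

/-- The flag number `f_K`: the number of chains of `Ω ∖ {0̂, 1̂}` whose set of ranks is
exactly `K`. -/
def flagF (r : α → ℕ) (K : Finset ℕ) : ℕ :=
  (Finset.univ.filter fun c : Finset α =>
    IsChain (· ≤ ·) (c : Set α) ∧ (∀ z ∈ c, z ≠ ⊥ ∧ z ≠ ⊤) ∧ c.image r = K).card

/-- The flag number `h_K = ∑_{T ⊆ K} (-1)^{|K ∖ T|} f_T`. -/
def flagH (r : α → ℕ) (K : Finset ℕ) : ℤ :=
  ∑ T ∈ K.powerset, (-1 : ℤ) ^ ((K \ T).card) * flagF r T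

/-- The ab-polynomial `Ψ = ∑_{K ⊆ [d]} h_K u_K`. -/
def abPoly (r : α → ℕ) (d : ℕ) : FreeAlgebra ℤ Bool :=
  ∑ K ∈ (Finset.Icc 1 d).powerset, flagH r K • abWord d K

/-- The chain polynomial `Υ = ∑_{K ⊆ [d]} f_K u_K`. -/
def chainPoly (r : α → ℕ) (d : ℕ) : FreeAlgebra ℤ Bool :=
  ∑ K ∈ (Finset.Icc 1 d).powerset, (flagF r K : ℤ) • abWord d K

end

noncomputable section CDProof

/-- Formal series in the noncommuting variables `e = a - b` (`false`) and `b` (`true`). -/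
abbrev Ser := List Bool → ℤ

def opX (x : Bool) : Ser →ₗ[ℤ] Ser where
  toFun F := fun w => match w with
    | [] => 0
    | y :: w => if y = x then F w else 0
  map_add' F G := by
    funext w
    cases w with
    | nil => simp
    | cons y w => by_cases h : y = x <;> simp [h]
  map_smul' k F := by
    funext w
    cases w with
    | nil => simp
    | cons y w => by_cases h : y = x <;> simp [h]

@[simp] lemma opX_nil (x : Bool) (F : Ser) : opX x F [] = 0 := rfl
@[simp] lemma opX_cons (x y : Bool) (F : Ser) (w : List Bool) :
    opX x F (y :: w) = if y = x then F w else 0 := rfl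

def opC : Ser →ₗ[ℤ] Ser := opX false + (2 : ℤ) • opX true
def opD : Ser →ₗ[ℤ] Ser :=
  opX false * opX true + opX true * opX false + (2 : ℤ) • (opX true * opX true)

lemma opC_nil (F : Ser) : opC F [] = 0 := by simp [opC]
lemma opC_e (F : Ser) (w) : opC F (false :: w) = F w := by simp [opC]
lemma opC_b (F : Ser) (w) : opC F (true :: w) = 2 * F w := by simp [opC]
lemma opD_nil (F : Ser) : opD F [] = 0 := by simp [opD]
lemma opD_e (F : Ser) (w) : opD F (false :: w) = opX true F w := by simp [opD]
lemma opD_b (F : Ser) (w) : opD F (true :: w) = opC F w := by simp [opD, opC]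

def rho : FreeAlgebra ℤ Bool →ₐ[ℤ] Module.End ℤ Ser :=
  FreeAlgebra.lift ℤ (fun x : Bool => if x then opX true else opX false + opX true)

lemma rho_a : rho genA = opX false + opX true := by simp [rho, genA]
lemma rho_b : rho genB = opX true := by simp [rho, genB]
lemma rho_e : rho (genA - genB) = opX false := by rw [map_sub, rho_a, rho_b]; simp

lemma rho_c : rho (genA + genB) = opC := by
  rw [map_add, rho_a, rho_b, opC, two_smul, add_assoc]

lemma rho_d : rho (genA * genB + genB * genA) = opD := by
  rw [map_add, map_mul, map_mul, rho_a, rho_b, opD, two_smul]; noncomm_ring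

/-- the defect of the Dehn–Sommerville relation -/
def Lam : ℕ → Ser → List Bool → ℤ
  | 0, _, _ => 0
  | n + 1, F, v => F (true :: (List.replicate n false ++ v))
      - 2 * F (false :: (List.replicate n false ++ v)) - Lam n (fun w => F (false :: w)) v

lemma Lam_add (n : ℕ) (F G : Ser) (v) :
    Lam n (fun w => F w + G w) v = Lam n F v + Lam n G v := by
  induction n generalizing F G with
  | zero => rfl
  | succ n ih => simp only [Lam, ih]; ring

lemma Lam_smul (n : ℕ) (k : ℤ) (F : Ser) (v) :
    Lam n (fun w => k * F w) v = k * Lam n F v := by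
  induction n generalizing F with
  | zero => simp [Lam]
  | succ n ih => simp only [Lam, ih]; ring

lemma Lam_zero (n : ℕ) (v) : Lam n (fun _ => 0) v = 0 := by
  induction n with
  | zero => rfl
  | succ n ih => simp [Lam, ih]

lemma Lam_C (n : ℕ) (F : Ser) (v) : Lam (n + 1) (opC F) v = - Lam n F v := by
  simp only [Lam, opC_e, opC_b]; ring

lemma Lam_D (n : ℕ) (F : Ser) (v) : Lam (n + 2) (opD F) v = 0 := by
  simp [Lam, opD_e, opD_b, opC_e, Lam_zero, List.replicate_succ]

lemma Lam_D1 (F : Ser) (v : List Bool) (hv : v.head? ≠ some false) : Lam 1 (opD F) v = 0 := by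
  rcases v with _ | ⟨_ | _, v⟩
  · simp [Lam, opD_e, opD_b, opC_nil]
  · simp at hv
  · simp [Lam, opD_e, opD_b, opC_b]

def Ok (F : Ser) : Prop := ∀ n v, v.head? ≠ some false → Lam n F v = 0

def DS (F : Ser) : Prop :=
  ∀ u : List Bool, u.getLast? ≠ some false → Ok (fun w => F (u ++ w))

lemma good_cases (u : List Bool) (h : u.getLast? ≠ some false) :
    u = [] ∨ ∃ m u', u'.getLast? ≠ some false ∧ u = List.replicate m false ++ true :: u' := by
  induction u with
  | nil => left; rfl
  | cons x u ih =>
    right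
    cases x with
    | true =>
      refine ⟨0, u, ?_, by simp⟩
      intro hu
      apply h
      rw [List.getLast?_cons, hu]; rfl
    | false =>
      have hu : u.getLast? ≠ some false := by
        intro hu
        apply h
        rw [List.getLast?_cons, hu]; rfl
      rcases ih hu with rfl | ⟨m, u', h1, rfl⟩
      · simp at h
      · exact ⟨m + 1, u', h1, by simp [List.replicate_succ]⟩

lemma DS_iff (F : Ser) :
    DS F ↔ Ok F ∧ ∀ m, DS (fun w => F (List.replicate m false ++ true :: w)) := by
  constructor
  · intro h
    refine ⟨by simpa using h [] (by simp), ?_⟩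
    intro m u hu
    have := h (List.replicate m false ++ true :: u) (by
      rw [List.getLast?_append, List.getLast?_cons]
      cases hc : u.getLast? with
      | none => simp
      | some x => rw [hc] at hu; simpa using hu)
    simpa using this
  · rintro ⟨h1, h2⟩ u hu
    rcases good_cases u hu with rfl | ⟨m, u', h, rfl⟩
    · simpa using h1
    · simpa using h2 m u' h

lemma DS.add {F G : Ser} (hF : DS F) (hG : DS G) : DS (fun w => F w + G w) := by
  intro u hu n v hv
  have := Lam_add n (fun w => F (u ++ w)) (fun w => G (u ++ w)) v
  rw [hF u hu n v hv, hG u hu n v hv] at this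
  simpa using this

lemma DS.smul {F : Ser} (k : ℤ) (hF : DS F) : DS (fun w => k * F w) := by
  intro u hu n v hv
  have := Lam_smul n k (fun w => F (u ++ w)) v
  rw [hF u hu n v hv] at this
  simpa using this

lemma DS.zero : DS (fun _ => 0) := fun _ _ n v _ => Lam_zero n v

lemma DS.C {F : Ser} (hF : DS F) : DS (opC F) := by
  have h := (DS_iff F).1 hF
  rw [DS_iff]
  constructor
  · intro n v hv
    cases n with
    | zero => rfl
    | succ n => rw [Lam_C, h.1 n v hv, neg_zero]
  · intro m
    cases m with
    | zero => simpa [opC_b] using hF.smul 2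
    | succ m => simpa [List.replicate_succ, opC_e] using h.2 m

lemma DS.D {F : Ser} (hF : DS F) : DS (opD F) := by
  rw [DS_iff]
  constructor
  · intro n v hv
    match n with
    | 0 => rfl
    | 1 => exact Lam_D1 F v hv
    | n + 2 => exact Lam_D n F v
  · intro m
    match m with
    | 0 => simpa [opD_b] using hF.C
    | 1 => simpa [List.replicate_succ, opD_e] using hF
    | m + 2 => simpa [List.replicate_succ, opD_e] using DS.zero

lemma DS_cdMap (x : FreeAlgebra ℤ Bool) : ∀ F, DS F → DS (rho (cdMap x) F) := by
  induction x using FreeAlgebra.induction with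
  | grade0 k =>
    intro F hF
    rw [AlgHom.commutes, AlgHom.commutes]
    exact hF.smul k
  | grade1 x =>
    intro F hF
    cases x with
    | false =>
      have : cdMap (FreeAlgebra.ι ℤ false) = genA + genB := by simp [cdMap]
      rw [this, rho_c]; exact hF.C
    | true =>
      have : cdMap (FreeAlgebra.ι ℤ true) = genA * genB + genB * genA := by simp [cdMap]
      rw [this, rho_d]; exact hF.D
  | mul x y hx hy =>
    intro F hF
    rw [map_mul, map_mul]
    exact hx _ (hy _ hF)
  | add x y hx hy =>
    intro F hF
    rw [map_add, map_add]
    exact (hx _ hF).add (hy _ hF)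

def unit0 : Ser := fun w => if w = [] then 1 else 0

lemma DS_unit0 : DS unit0 := by
  rw [DS_iff]
  constructor
  · intro n v hv
    cases n with
    | zero => rfl
    | succ n => simp [Lam, unit0, Lam_zero]
  · intro m
    simpa [unit0] using DS.zero

/-- Degree `n` part of a series as an element of the free algebra. -/
def rec' : ℕ → Ser → FreeAlgebra ℤ Bool
  | 0, F => F [] • 1
  | n + 1, F => (genA - genB) * rec' n (fun w => F (false :: w))
      + genB * rec' n (fun w => F (true :: w))

lemma rec'_add (n : ℕ) (F G : Ser) :
    rec' n (fun w => F w + G w) = rec' n F + rec' n G := by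
  induction n generalizing F G with
  | zero => simp [rec', add_smul]
  | succ n ih => simp only [rec', ih]; noncomm_ring

lemma rec'_smul (n : ℕ) (k : ℤ) (F : Ser) :
    rec' n (fun w => k * F w) = k • rec' n F := by
  induction n generalizing F with
  | zero => simp [rec', mul_smul]
  | succ n ih => simp only [rec', ih, mul_smul_comm, smul_add]

lemma rec'_zero (n : ℕ) : rec' n (fun _ => 0) = 0 := by
  induction n with
  | zero => simp [rec']
  | succ n ih => simp [rec', ih]

lemma rec'_congr (n : ℕ) (F G : Ser) (h : ∀ w, w.length = n → F w = G w) :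
    rec' n F = rec' n G := by
  induction n generalizing F G with
  | zero => simp [rec', h []]
  | succ n ih =>
    simp only [rec']
    rw [ih _ (fun w => G (false :: w)) (fun w hw => h _ (by simp [hw])),
      ih _ (fun w => G (true :: w)) (fun w hw => h _ (by simp [hw]))]

lemma rec'_back (n : ℕ) (F : Ser) :
    rec' (n + 1) F = rec' n (fun w => F (w ++ [false])) * (genA - genB)
      + rec' n (fun w => F (w ++ [true])) * genB := by
  induction n generalizing F with
  | zero => simp only [rec', List.nil_append, mul_smul_comm, smul_mul_assoc, mul_one, one_mul]
  | succ n ih =>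
    rw [rec', ih, ih]
    simp only [rec', List.cons_append]
    noncomm_ring

lemma rho_rec' (n : ℕ) (F : Ser) (w : List Bool) :
    rho (rec' n F) unit0 w = if w.length = n then F w else 0 := by
  induction n generalizing F w with
  | zero =>
    rw [rec', map_zsmul, map_one]
    cases w <;> simp [unit0]
  | succ n ih =>
    rw [rec', map_add, map_mul, map_mul, rho_e, rho_b]
    rcases w with _ | ⟨_ | _, w⟩
    · simp
    · simp [ih]
    · simp [ih]

lemma mem_c : genA + genB ∈ cdMap.range := ⟨FreeAlgebra.ι ℤ false, by simp [cdMap]⟩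
lemma mem_d : genA * genB + genB * genA ∈ cdMap.range :=
  ⟨FreeAlgebra.ι ℤ true, by simp [cdMap]⟩

section step
variable (F : Ser)

def Npart : Ser := fun w => F (true :: false :: w) - 2 * F (false :: false :: w)
def Mpart : Ser := fun w => F (false :: w) - opX true (Npart F) w

lemma A_eq (w) : F (false :: w) = Mpart F w + opX true (Npart F) w := by simp [Mpart]

lemma B_eq (h : Ok F) (w) : F (true :: w) = 2 * Mpart F w + opC (Npart F) w := by
  rcases w with _ | ⟨_ | _, w⟩
  · have := h 1 [] (by simp)
    simp [Lam] at this
    simp [Mpart, opC_nil]; linarith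
  · simp [Mpart, opC_e, Npart]
  · have := h 1 (true :: w) (by simp)
    simp [Lam] at this
    simp [Mpart, opC_b]; linarith

lemma F_eq (h : Ok F) (w) (hw : w ≠ []) : F w = opC (Mpart F) w + opD (Npart F) w := by
  rcases w with _ | ⟨_ | _, w⟩
  · simp at hw
  · rw [opC_e, opD_e, A_eq F]
  · rw [opC_b, opD_b, B_eq F h]

lemma Ok_Mpart (h : Ok F) : ∀ n v, v.head? ≠ some false → Lam n (Mpart F) v = 0 := by
  intro n v hv
  cases n with
  | zero => rfl
  | succ n =>
    have h1 := h (n + 2) v hv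
    have h2 : Lam (n + 2) F v = Lam (n + 2) (fun w => opC (Mpart F) w + opD (Npart F) w) v := by
      have : (fun w => F (false :: w)) =
        fun w => opC (Mpart F) (false :: w) + opD (Npart F) (false :: w) := by
        funext w; exact F_eq F h _ (by simp)
      have e1 : ∀ G : Ser, Lam (n + 2) G v = G (true :: (List.replicate (n + 1) false ++ v))
          - 2 * G (false :: (List.replicate (n + 1) false ++ v))
          - Lam (n + 1) (fun w => G (false :: w)) v := fun _ => rfl
      rw [e1, e1, this, F_eq F h (true :: _) (by simp), F_eq F h (false :: _) (by simp)]
    rw [Lam_add, Lam_C, Lam_D] at h2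
    linarith

lemma DS_Npart (h : DS F) : DS (Npart F) := by
  have hF := (DS_iff F).1 h
  have hQ : DS (fun w => F (true :: w)) := by simpa using hF.2 0
  have hQ' := (DS_iff _).1 hQ
  rw [DS_iff]
  constructor
  · intro n v hv
    have h1 := hQ'.1 (n + 1) v hv
    have h2 : (fun w => F (true :: w)) = fun w => 2 * Mpart F w + opC (Npart F) w := by
      funext w; exact B_eq F hF.1 w
    rw [h2, Lam_add _ (fun w => 2 * Mpart F w) (opC (Npart F)), Lam_smul,
      Ok_Mpart F hF.1 _ v hv, Lam_C] at h1
    linarith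
  · intro m
    have h1 := hQ'.2 (m + 1)
    have h2 := (hF.2 (m + 2)).smul (-2)
    have := h1.add h2
    convert this using 2 with w
    simp [Npart, List.replicate_succ]; ring

lemma DS_Mpart (h : DS F) : DS (Mpart F) := by
  have hF := (DS_iff F).1 h
  rw [DS_iff]
  refine ⟨Ok_Mpart F hF.1, ?_⟩
  intro m
  cases m with
  | zero =>
    have := (hF.2 1).add ((DS_Npart F h).smul (-1))
    convert this using 2 with w
    simp [Mpart]; ring
  | succ m =>
    convert hF.2 (m + 2) using 2 with w
    simp [Mpart, List.replicate_succ]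

end step

lemma rec'_mem (n : ℕ) : ∀ F, DS F → rec' n F ∈ cdMap.range := by
  induction n using Nat.strong_induction_on with
  | _ n ih =>
    intro F hF
    have hok := ((DS_iff F).1 hF).1
    have hA : (fun w => F (false :: w)) = fun w => Mpart F w + opX true (Npart F) w := by
      funext w; exact A_eq F w
    have hB : (fun w => F (true :: w)) = fun w => 2 * Mpart F w + opC (Npart F) w := by
      funext w; exact B_eq F hok w
    match n with
    | 0 => rw [rec']; exact Subalgebra.zsmul_mem _ (one_mem _) _
    | 1 =>
      have hM := ih 0 (by omega) _ (DS_Mpart F hF)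
      have : rec' 1 F = (genA + genB) * rec' 0 (Mpart F) := by
        have e1 : rec' 1 F = (genA - genB) * rec' 0 (fun w => F (false :: w))
          + genB * rec' 0 (fun w => F (true :: w)) := rfl
        rw [e1, hA, hB, rec'_add, rec'_add _ (fun w => 2 * Mpart F w), rec'_smul]
        have h1 : rec' 0 (opX true (Npart F)) = 0 := by simp [rec']
        have h2 : rec' 0 (opC (Npart F)) = 0 := by simp [rec', opC_nil]
        rw [h1, h2]
        noncomm_ring
      rw [this]
      exact mul_mem mem_c hM
    | n + 2 =>
      have hM := ih (n + 1) (by omega) _ (DS_Mpart F hF)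
      have hN := ih n (by omega) _ (DS_Npart F hF)
      have : rec' (n + 2) F = (genA + genB) * rec' (n + 1) (Mpart F)
          + (genA * genB + genB * genA) * rec' n (Npart F) := by
        rw [rec', hA, hB, rec'_add, rec'_add _ (fun w => 2 * Mpart F w), rec'_smul]
        have h1 : rec' (n + 1) (opX true (Npart F)) = genB * rec' n (Npart F) := by
          simp [rec', rec'_zero]
        have h2 : rec' (n + 1) (opC (Npart F)) = (genA + genB) * rec' n (Npart F) := by
          simp only [rec', opC_e, opC_b, rec'_smul]
          noncomm_ring
        rw [h1, h2]
        noncomm_ring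
      rw [this]
      exact add_mem (mul_mem mem_c hM) (mul_mem mem_d hN)

/-! Words and sets -/

def kset (w : List Bool) : Finset ℕ :=
  ((Finset.range w.length).filter fun i => w[i]? = some true).image (· + 1)

lemma mem_kset (w : List Bool) (x : ℕ) : x ∈ kset w ↔ 1 ≤ x ∧ w[x - 1]? = some true := by
  simp only [kset, Finset.mem_image, Finset.mem_filter, Finset.mem_range]
  constructor
  · rintro ⟨y, ⟨_, h⟩, rfl⟩; exact ⟨by omega, by simpa using h⟩
  · rintro ⟨h, h'⟩
    refine ⟨x - 1, ⟨?_, h'⟩, by omega⟩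
    by_contra hc
    rw [List.getElem?_eq_none (by omega)] at h'
    simp at h'

lemma kset_e (w : List Bool) : kset (w ++ [false]) = kset w := by
  ext x
  simp only [mem_kset, List.getElem?_append]
  grind

lemma kset_b (w : List Bool) : kset (w ++ [true]) = insert (w.length + 1) (kset w) := by
  ext x
  simp only [mem_kset, List.getElem?_append, Finset.mem_insert]
  grind

def gH (g : Finset ℕ → ℤ) (K : Finset ℕ) : ℤ :=
  ∑ T ∈ K.powerset, (-1 : ℤ) ^ ((K \ T).card) * g T

lemma gH_insert (g : Finset ℕ → ℤ) (K : Finset ℕ) (x : ℕ) (hx : x ∉ K) :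
    gH g (insert x K) = gH (fun T => g (insert x T)) K - gH g K := by
  unfold gH
  rw [Finset.sum_powerset_insert hx, sub_eq_add_neg, add_comm, ← Finset.sum_neg_distrib]
  congr 1
  · refine Finset.sum_congr rfl fun T hT => ?_
    have : insert x K \ insert x T = K \ T := by
      ext y; simp only [Finset.mem_sdiff, Finset.mem_insert]
      grind
    rw [this]
  · refine Finset.sum_congr rfl fun T hT => ?_
    rw [Finset.mem_powerset] at hT
    have : insert x K \ T = insert x (K \ T) := Finset.insert_sdiff_of_notMem _ (fun h => hx (hT h))
    rw [this, Finset.card_insert_of_notMem (by simp [hx]), pow_succ]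
    ring

lemma abWord_succ (d : ℕ) (K : Finset ℕ) :
    abWord (d + 1) K = abWord d K * (if d + 1 ∈ K then genB else genA) := by
  simp [abWord, List.range_succ]

lemma abWord_insert (d : ℕ) (K : Finset ℕ) : abWord d (insert (d + 1) K) = abWord d K := by
  unfold abWord
  congr 1
  apply List.map_congr_left
  intro i hi
  rw [List.mem_range] at hi
  have : i ≠ d := by omega
  simp [this]

lemma ab_eq_rec' (d : ℕ) (g : Finset ℕ → ℤ) :
    ∑ K ∈ (Finset.Icc 1 d).powerset, gH g K • abWord d K = rec' d (fun w => g (kset w)) := by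
  induction d generalizing g with
  | zero => simp [rec', gH, abWord, kset]
  | succ d ih =>
    rw [rec'_back]
    have h1 : rec' d (fun w => g (kset (w ++ [false]))) = rec' d (fun w => g (kset w)) := by
      simp only [kset_e]
    have h2 : rec' d (fun w => g (kset (w ++ [true])))
        = rec' d (fun w => (fun T => g (insert (d + 1) T)) (kset w)) := by
      apply rec'_congr
      intro w hw
      simp only [kset_b, hw]
    rw [h1, h2, ← ih, ← ih (fun T => g (insert (d + 1) T))]
    have hI : Finset.Icc 1 (d + 1) = insert (d + 1) (Finset.Icc 1 d) := by
      ext x; simp only [Finset.mem_insert, Finset.mem_Icc]; omega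
    rw [hI, Finset.sum_powerset_insert (by simp), Finset.sum_mul, Finset.sum_mul,
      ← Finset.sum_add_distrib, ← Finset.sum_add_distrib]
    refine Finset.sum_congr rfl fun K hK => ?_
    have hd : d + 1 ∉ K := fun h => by
      have := Finset.mem_Icc.1 (Finset.mem_powerset.1 hK h); omega
    rw [gH_insert _ _ _ hd, abWord_succ, abWord_succ, abWord_insert, if_neg hd, if_pos (by simp)]
    simp only [sub_smul, smul_mul_assoc, mul_sub, smul_sub]
    abel

/-! Dehn–Sommerville equations in terms of words -/

lemma Lam_eq_sum (n : ℕ) (F : Ser) (v) :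
    Lam n F v = ∑ j ∈ Finset.range n, (-1 : ℤ) ^ j *
        F (List.replicate j false ++ true :: (List.replicate (n - 1 - j) false ++ v))
      - (1 - (-1) ^ n) * F (List.replicate n false ++ v) := by
  induction n generalizing F with
  | zero => simp [Lam]
  | succ n ih =>
    rw [Lam, ih, Finset.sum_range_succ']
    have : ∀ j, n + 1 - 1 - (j + 1) = n - 1 - j := by intro j; omega
    simp only [this, List.replicate_succ, List.cons_append, pow_succ]
    simp only [mul_neg_one, neg_mul, Finset.sum_neg_distrib]
    simp
    ring

def serOf (d : ℕ) (g : Finset ℕ → ℤ) : Ser := fun w => if w.length = d then g (kset w) else 0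

lemma kset_mid (u v : List Bool) (n j : ℕ) (hj : j < n) :
    kset (u ++ (List.replicate j false ++ true :: (List.replicate (n - 1 - j) false ++ v)))
      = kset (u ++ (List.replicate n false ++ v)) ∪ {u.length + j + 1} := by
  ext x
  simp only [mem_kset, Finset.mem_union, Finset.mem_singleton, List.getElem?_append,
    List.getElem?_cons, List.length_replicate, List.getElem?_replicate]
  grind

lemma Lam_serOf (d : ℕ) (g : Finset ℕ → ℤ) (u v : List Bool) (n : ℕ)
    (hl : u.length + n + v.length = d) :
    Lam n (fun w => serOf d g (u ++ w)) v =
      ∑ j ∈ Finset.Ioo u.length (u.length + n + 1), (-1 : ℤ) ^ (j - u.length - 1) *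
        g (kset (u ++ (List.replicate n false ++ v)) ∪ {j})
      - (1 - (-1) ^ n) * g (kset (u ++ (List.replicate n false ++ v))) := by
  rw [Lam_eq_sum]
  congr 1
  · have : Finset.Ioo u.length (u.length + n + 1)
        = (Finset.range n).image (fun j => u.length + j + 1) := by
      ext x
      simp only [Finset.mem_Ioo, Finset.mem_image, Finset.mem_range]
      constructor
      · intro h; exact ⟨x - u.length - 1, by omega, by omega⟩
      · rintro ⟨y, h, rfl⟩; omega
    rw [this, Finset.sum_image (by intro a _ b _ h; simpa using h)]
    refine Finset.sum_congr rfl fun j hj => ?_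
    rw [Finset.mem_range] at hj
    have h1 : u.length + j + 1 - u.length - 1 = j := by omega
    rw [h1, ← kset_mid u v n j hj, serOf, if_pos]
    simp; omega
  · rw [serOf, if_pos]
    simp; omega

lemma Lam_serOf_ne (d : ℕ) (g : Finset ℕ → ℤ) (u v : List Bool) (n : ℕ)
    (hl : u.length + n + v.length ≠ d) :
    Lam n (fun w => serOf d g (u ++ w)) v = 0 := by
  rw [Lam_eq_sum, Finset.sum_eq_zero, serOf, if_neg]
  · simp
  · simp; omega
  · intro j hj
    rw [Finset.mem_range] at hj
    rw [serOf, if_neg]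
    · simp
    · simp; omega

lemma DS_serOf (d : ℕ) (g : Finset ℕ → ℤ) :
    (∀ K ∈ (Finset.Icc 1 d).powerset, ∀ i ∈ K ∪ {0, d + 1}, ∀ k ∈ K ∪ {0, d + 1},
        i + 2 ≤ k → (∀ j ∈ K, ¬(i < j ∧ j < k)) →
        ∑ j ∈ Finset.Ioo i k, (-1 : ℤ) ^ (j - i - 1) * g (K ∪ {j}) =
          (1 - (-1 : ℤ) ^ (k - i - 1)) * g K) ↔ DS (serOf d g) := by
  constructor
  · intro h u hu n v hv
    by_cases hl : u.length + n + v.length = d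
    swap
    · exact Lam_serOf_ne d g u v n hl
    rcases Nat.eq_zero_or_pos n with rfl | hn
    · rfl
    rw [Lam_serOf d g u v n hl, sub_eq_zero]
    have key := h (kset (u ++ (List.replicate n false ++ v))) ?_ u.length ?_
      (u.length + n + 1) ?_ (by omega) ?_
    · rw [key]
      have : u.length + n + 1 - u.length - 1 = n := by omega
      rw [this]
    · rw [Finset.mem_powerset]
      intro x hx
      rw [mem_kset] at hx
      rw [Finset.mem_Icc]
      refine ⟨hx.1, ?_⟩
      by_contra hc
      rw [List.getElem?_eq_none (by simp; omega)] at hx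
      simp at hx
    · simp only [Finset.mem_union, mem_kset, Finset.mem_insert, Finset.mem_singleton]
      rcases Nat.eq_zero_or_pos u.length with h0 | h0
      · right; left; exact h0
      · left
        refine ⟨h0, ?_⟩
        rw [List.getElem?_append_left (by omega), ← List.getLast?_eq_getElem?]
        cases hc : u.getLast? with
        | none => simp at hc; simp [hc] at h0
        | some x =>
          cases x with
          | true => rfl
          | false => exact absurd hc hu
    · simp only [Finset.mem_union, mem_kset, Finset.mem_insert, Finset.mem_singleton]
      rcases v with _ | ⟨x, v⟩
      · right; right; simp at hl; omega
      · left
        refine ⟨by omega, ?_⟩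
        have : x = true := by
          cases x with
          | true => rfl
          | false => exact absurd rfl hv
        subst this
        rw [List.getElem?_append_right (by omega), List.getElem?_append_right (by simp)]
        simp
    · intro j hj hc
      rw [mem_kset, List.getElem?_append_right (by omega),
        List.getElem?_append_left (by simp; omega)] at hj
      simp [List.getElem?_replicate] at hj
  · intro h K hK i hi k hk hik hj
    rw [Finset.mem_powerset] at hK
    have hKd : ∀ x ∈ K, 1 ≤ x ∧ x ≤ d := fun x hx => Finset.mem_Icc.1 (hK hx)
    simp only [Finset.mem_union, Finset.mem_insert, Finset.mem_singleton] at hi hk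
    have hkd : k ≤ d + 1 := by
      rcases hk with hk | hk | hk
      · have := hKd k hk; omega
      · omega
      · omega
    let W : ℕ → Bool := fun x => decide (x + 1 ∈ K)
    let u := (List.range i).map W
    let v := (List.range (d + 1 - k)).map (fun x => W (x + (k - 1)))
    have hul : u.length = i := by simp [u]
    have hvl : v.length = d + 1 - k := by simp [v]
    obtain ⟨n, hn⟩ : ∃ n, k = i + n + 1 := ⟨k - i - 1, by omega⟩
    have hu : u.getLast? ≠ some false := by
      rcases Nat.eq_zero_or_pos i with h0 | h0
      · simp [u, h0]
      · have hiK : i ∈ K := by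
          rcases hi with hi | hi | hi
          · exact hi
          · omega
          · omega
        rw [List.getLast?_eq_getElem?, hul]
        have : i - 1 < i := by omega
        have h2 : i - 1 + 1 = i := by omega
        simp [u, W, this, h2, hiK]
    have hv : v.head? ≠ some false := by
      rcases Nat.eq_zero_or_pos (d + 1 - k) with h0 | h0
      · simp [v, h0]
      · have hkK : k ∈ K := by
          rcases hk with hk | hk | hk
          · exact hk
          · omega
          · omega
        rw [List.head?_eq_getElem?]
        have h2 : k - 1 + 1 = k := by omega
        simp [v, W, h0, h2, hkK]
    have hk' : kset (u ++ (List.replicate n false ++ v)) = K := by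
      ext x
      rw [mem_kset]
      simp only [List.getElem?_append, hul, List.length_replicate, List.getElem?_replicate]
      by_cases hx : 1 ≤ x
      swap
      · have : x ∉ K := fun h => hx (hKd x h).1
        simp [hx, this]
      have hxx : x - 1 + 1 = x := by omega
      by_cases h1 : x - 1 < i
      · simp [h1, u, W, hx, hxx]
      · by_cases h2 : x - 1 - i < n
        · have : x ∉ K := fun h => hj x h (by omega)
          simp [h1, h2, this]
        · by_cases h3 : x ≤ d
          · have h4 : x - 1 - i - n < d + 1 - k := by omega
            have h5 : x - 1 - i - n + (k - 1) + 1 = x := by omega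
            simp [h1, h2, v, W, hx, h4, h5]
          · have : x ∉ K := fun h => h3 (hKd x h).2
            have h4 : ¬ (x - 1 - i - n < d + 1 - k) := by omega
            simp [h1, h2, v, this, h4]
    have key := h u hu n v hv
    rw [Lam_serOf d g u v n (by omega), hk', hul, sub_eq_zero] at key
    subst hn
    have : i + n + 1 - i - 1 = n := by omega
    rw [this]
    exact key

lemma main_general (d : ℕ) (g : Finset ℕ → ℤ) :
    DS (serOf d g) ↔
      ∑ K ∈ (Finset.Icc 1 d).powerset, gH g K • abWord d K ∈ Set.range cdMap := by
  have h1 : rec' d (fun w => g (kset w)) = rec' d (serOf d g) := by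
    apply rec'_congr
    intro w hw
    simp [serOf, hw]
  rw [ab_eq_rec', h1]
  constructor
  · intro h
    exact rec'_mem d _ h
  · rintro ⟨x, hx⟩
    have h2 := DS_cdMap x unit0 DS_unit0
    rw [hx] at h2
    convert h2 using 1
    funext w
    rw [rho_rec']
    by_cases hw : w.length = d <;> simp [serOf, hw]

end CDProof

/-- Bayer–Klapper: a graded bounded poset of rank `d+1` has a cd-index (its ab-polynomial
lies in the image of `c ↦ a+b, d ↦ ab+ba`) if and only if its flag `f`-vector satisfies
the generalized Dehn–Sommerville equations. -/
theorem has_cdIndex_iff_dehnSommerville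
    {α : Type*} [Fintype α] [PartialOrder α] [BoundedOrder α] (d : ℕ) (r : α → ℕ)
    (hbot : r ⊥ = 0) (htop : r ⊤ = d + 1)
    (hgraded : ∀ a b : α, a ⋖ b → r b = r a + 1) :
    (∀ K ∈ (Finset.Icc 1 d).powerset, ∀ i ∈ K ∪ {0, d + 1}, ∀ k ∈ K ∪ {0, d + 1},
        i + 2 ≤ k → (∀ j ∈ K, ¬(i < j ∧ j < k)) →
        ∑ j ∈ Finset.Ioo i k, (-1 : ℤ) ^ (j - i - 1) * (flagF r (K ∪ {j}) : ℤ) =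
          (1 - (-1 : ℤ) ^ (k - i - 1)) * (flagF r K : ℤ)) ↔
    abPoly r d ∈ Set.range cdMap := by
  rw [DS_serOf d (fun K => (flagF r K : ℤ)), main_general]
  rfl
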